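/- For every t with 0 ≤ t < c, the four-dimensional Lebesgue measure of the set {(P,Q) ∈ T × T : ‖P − Q‖ ≤ t} equals A² · G(t), where G(t) = (1/A)·[t²(π − (2u/(3A))·t) + (2/A)·J°(t)]; moreover this measure equals A² for t ≥ c. In other words, G is the distribution function of the distance between two independent uniformly distributed random points in T. -/

import Mathlib

open Real MeasureTheory

/-- The integral of the squared linear function `(1 - x)₊ ^ 2` along the arc of radius `k` and
opening angle `β` starting on the positive `x`-axis. -/
noncomputable def arcIntegral (β k : ℝ) : ℝ :=
  ∫ φ in (0 : ℝ)..β, (max 0 (1 - k * cos φ)) ^ 2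

lemma integral_one_sub_mul_cos_sq (k x y : ℝ) :
    ∫ φ in x..y, (1 - k * cos φ) ^ 2 = (y - x) - 2 * k * (sin y - sin x)
      + k ^ 2 / 2 * (y - x + sin y * cos y - sin x * cos x) := by
  have hd : ∀ φ ∈ Set.uIcc x y, HasDerivAt
      (fun φ => φ - 2 * k * sin φ + k ^ 2 / 2 * (φ + sin φ * cos φ)) ((1 - k * cos φ) ^ 2) φ := by
    intro φ _
    have h := (((hasDerivAt_id φ).sub ((hasDerivAt_sin φ).const_mul (2 * k))).add
      (((hasDerivAt_id φ).add ((hasDerivAt_sin φ).mul (hasDerivAt_cos φ))).const_mul (k ^ 2 / 2)))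
    refine h.congr_deriv ?_
    linear_combination (-(k ^ 2 / 2)) * sin_sq_add_cos_sq φ
  rw [intervalIntegral.integral_eq_sub_of_hasDerivAt hd
    (Continuous.intervalIntegrable (by fun_prop) _ _)]
  ring

lemma continuous_arcIntegral (β : ℝ) : Continuous (arcIntegral β) := by
  unfold arcIntegral
  refine intervalIntegral.continuous_parametric_intervalIntegral_of_continuous' (by fun_prop) _ _

lemma arcIntegral_of_le_one {β k : ℝ} (hk₀ : 0 ≤ k) (hk : k ≤ 1) :
    arcIntegral β k = β - 2 * k * sin β + k ^ 2 / 2 * (β + sin β * cos β) := by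
  have h : ∀ φ : ℝ, (max 0 (1 - k * cos φ)) ^ 2 = (1 - k * cos φ) ^ 2 := fun φ => by
    rw [max_eq_right]
    nlinarith [cos_le_one φ]
  simp only [arcIntegral, h, integral_one_sub_mul_cos_sq]
  simp

lemma arcIntegral_eq_zero {β k : ℝ} (hβ₀ : 0 ≤ β) (hβ : β ≤ π) (hk₀ : 0 ≤ k)
    (hk : 1 ≤ k * cos β) : arcIntegral β k = 0 := by
  rw [arcIntegral, intervalIntegral.integral_congr (g := fun _ => 0),
    intervalIntegral.integral_zero]
  intro φ hφ
  rw [Set.uIcc_of_le hβ₀] at hφ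
  have := cos_le_cos_of_nonneg_of_le_pi hφ.1 hβ hφ.2
  have h : 1 - k * cos φ ≤ 0 := by nlinarith
  simp [h]

lemma arcIntegral_of_one_le {β k : ℝ} (hβ₀ : 0 ≤ β) (hβ : β ≤ π) (hk₁ : 1 ≤ k)
    (hk : k * cos β ≤ 1) :
    arcIntegral β k = β - 2 * k * sin β + k ^ 2 / 2 * (β + sin β * cos β)
      - (arccos (1 / k) * (1 + k ^ 2 / 2) - 3 / 2 * √(k ^ 2 - 1)) := by
  have hk' : 0 < k := by linarith
  set δ := arccos (1 / k) with hδ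
  have hδ₀ : 0 ≤ δ := arccos_nonneg _
  have hδπ : δ ≤ π := arccos_le_pi _
  have hc : cos δ = 1 / k :=
    cos_arccos (by linarith [one_div_pos.2 hk']) ((div_le_one hk').2 hk₁)
  have hs : sin δ = √(k ^ 2 - 1) / k := by
    rw [hδ, sin_arccos, ← sqrt_sq hk'.le, ← sqrt_div' _ (sq_nonneg k), sqrt_sq hk'.le]
    congr 1
    field_simp
  have hδβ : δ ≤ β := by
    rw [← strictAntiOn_cos.le_iff_ge ⟨hβ₀, hβ⟩ ⟨hδ₀, hδπ⟩, hc, le_div_iff₀ hk', mul_comm]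
    exact hk
  have hcont : Continuous fun φ => (max 0 (1 - k * cos φ)) ^ 2 := by fun_prop
  have h₁ : ∫ φ in (0 : ℝ)..δ, (max 0 (1 - k * cos φ)) ^ 2 = 0 :=
    arcIntegral_eq_zero hδ₀ hδπ hk'.le (by rw [hc]; field_simp; rfl)
  have h₂ : ∫ φ in δ..β, (max 0 (1 - k * cos φ)) ^ 2 = ∫ φ in δ..β, (1 - k * cos φ) ^ 2 := by
    refine intervalIntegral.integral_congr fun φ hφ => ?_
    rw [Set.uIcc_of_le hδβ] at hφ
    have := cos_le_cos_of_nonneg_of_le_pi hδ₀ (hφ.2.trans hβ) hφ.1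
    rw [hc, le_div_iff₀ hk'] at this
    rw [max_eq_right (by linarith)]
  rw [arcIntegral, ← intervalIntegral.integral_add_adjacent_intervals
    (hcont.intervalIntegrable 0 δ) (hcont.intervalIntegrable δ β), h₁, h₂,
    integral_one_sub_mul_cos_sq, hc, hs]
  field_simp
  ring

/-- The correction to the polynomial `sectorPoly` caused by the part of a circular sector on which
`1 - x` is negative. -/
noncomputable def sectorCorrection (k : ℝ) : ℝ :=
  (k ^ 2 / 2 + k ^ 4 / 8) * arccos (1 / k) - 5 / 8 * √(k ^ 2 - 1) - 13 / 24 * √(k ^ 2 - 1) ^ 3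

/-- The integral of `(1 - x) ^ 2` over the circular sector of radius `k` and angle `β`. -/
noncomputable def sectorPoly (β k : ℝ) : ℝ :=
  β * k ^ 2 / 2 - 2 / 3 * k ^ 3 * sin β + k ^ 4 / 8 * (β + sin β * cos β)

lemma sectorCorrection_of_le_one {k : ℝ} (hk₀ : 0 ≤ k) (hk : k ≤ 1) : sectorCorrection k = 0 := by
  rcases hk₀.eq_or_lt with rfl | hk'
  · simp [sectorCorrection, sqrt_eq_zero_of_nonpos]
  · rw [sectorCorrection, arccos_of_one_le ((one_le_div hk').2 hk),
      sqrt_eq_zero_of_nonpos (by nlinarith)]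
    ring

lemma hasDerivAt_sectorPoly (β k : ℝ) : HasDerivAt (sectorPoly β)
    (k * (β - 2 * k * sin β + k ^ 2 / 2 * (β + sin β * cos β))) k := by
  have h := ((((hasDerivAt_pow 2 k).const_mul β).div_const 2).sub
    (((hasDerivAt_pow 3 k).const_mul (2 / 3)).mul_const (sin β))).add
    (((hasDerivAt_pow 4 k).div_const 8).mul_const (β + sin β * cos β))
  refine h.congr_deriv ?_
  push_cast
  ring

lemma hasDerivAt_sectorCorrection {k : ℝ} (hk : 1 < k) : HasDerivAt sectorCorrection
    (k * (arccos (1 / k) * (1 + k ^ 2 / 2) - 3 / 2 * √(k ^ 2 - 1))) k := by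
  have hk₀ : 0 < k := by linarith
  have hs : 0 < k ^ 2 - 1 := by nlinarith
  have hs' : 0 < √(k ^ 2 - 1) := sqrt_pos.2 hs
  have hsq : HasDerivAt (fun k : ℝ => √(k ^ 2 - 1)) (k / √(k ^ 2 - 1)) k := by
    refine (((hasDerivAt_pow 2 k).sub_const 1).sqrt hs.ne').congr_deriv ?_
    field_simp
    simp [mul_comm]
  have hinv : HasDerivAt (fun k : ℝ => 1 / k) (-(1 / k ^ 2)) k := by
    simpa using hasDerivAt_inv hk₀.ne'
  have harc : HasDerivAt (fun k : ℝ => arccos (1 / k)) (1 / (k * √(k ^ 2 - 1))) k := by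
    have h1 : 1 / k < 1 := (div_lt_one hk₀).2 hk
    have h2 := (hasDerivAt_arccos (by linarith [one_div_pos.2 hk₀]) h1.ne).comp k hinv
    refine h2.congr_deriv ?_
    have : √(1 - (1 / k) ^ 2) = √(k ^ 2 - 1) / k := by
      nth_rw 3 [← sqrt_sq hk₀.le]
      rw [← sqrt_div' _ (sq_nonneg k)]
      congr 1
      field_simp
    rw [this]
    field_simp
  have hq : HasDerivAt (fun k : ℝ => k ^ 2 / 2 + k ^ 4 / 8) (k + k ^ 3 / 2) k := by
    refine (((hasDerivAt_pow 2 k).div_const 2).add ((hasDerivAt_pow 4 k).div_const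
      8)).congr_deriv ?_
    push_cast
    ring
  have h := ((hq.mul harc).sub (hsq.const_mul (5 / 8))).sub ((hsq.pow 3).const_mul (13 / 24))
  refine h.congr_deriv ?_
  have e := sq_sqrt hs.le
  push_cast
  field_simp
  linear_combination (-48) * e

lemma integral_mul_arcIntegral_of_mul_cos_le {β k : ℝ} (hβ₀ : 0 ≤ β) (hβ : β ≤ π / 2) (hk₀ : 0 ≤ k)
    (hk : k * cos β ≤ 1) :
    ∫ r in (0 : ℝ)..k, r * arcIntegral β r = sectorPoly β k - sectorCorrection k := by
  have hcont : Continuous fun r => r * arcIntegral β r :=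
    continuous_id.mul (continuous_arcIntegral β)
  have hP : Continuous (sectorPoly β) := by unfold sectorPoly; fun_prop
  have key : ∀ x, 0 ≤ x → x ≤ 1 → ∫ r in (0 : ℝ)..x, r * arcIntegral β r = sectorPoly β x := by
    intro x hx₀ hx
    rw [intervalIntegral.integral_eq_sub_of_hasDerivAt_of_le (f := sectorPoly β) hx₀
      hP.continuousOn _ (hcont.intervalIntegrable _ _)]
    · simp [sectorPoly]
    · intro r hr
      rw [arcIntegral_of_le_one hr.1.le (hr.2.le.trans hx)]
      exact hasDerivAt_sectorPoly β r
  rcases le_total k 1 with hk₁ | hk₁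
  · rw [key k hk₀ hk₁, sectorCorrection_of_le_one hk₀ hk₁, sub_zero]
  · rw [← intervalIntegral.integral_add_adjacent_intervals (hcont.intervalIntegrable 0 1)
      (hcont.intervalIntegrable 1 k), key 1 zero_le_one le_rfl,
      intervalIntegral.integral_eq_sub_of_hasDerivAt_of_le
        (f := fun r => sectorPoly β r - sectorCorrection r) hk₁ _ _ (hcont.intervalIntegrable _ _)]
    · simp only [sectorCorrection_of_le_one zero_le_one le_rfl]
      ring
    · refine hP.continuousOn.sub ?_
      unfold sectorCorrection
      have : ContinuousOn (fun r : ℝ => 1 / r) (Set.Icc 1 k) :=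
        continuousOn_const.div continuousOn_id fun x hx => by
          have := hx.1
          exact (zero_lt_one.trans_le this).ne'
      have h2 := continuous_arccos.comp_continuousOn this
      have h3 : Continuous fun k : ℝ => √(k ^ 2 - 1) := by fun_prop
      have h4 : Continuous fun k : ℝ => (k ^ 2 / 2 + k ^ 4 / 8) := by fun_prop
      exact ((h4.continuousOn.mul h2).sub (h3.const_mul _).continuousOn).sub
        ((h3.pow 3).const_mul _).continuousOn
    · intro r hr
      have hcos : 0 ≤ cos β := cos_nonneg_of_neg_pi_div_two_le_of_le (by linarith [pi_pos]) hβ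
      rw [arcIntegral_of_one_le hβ₀ (by linarith [pi_pos]) hr.1.le
        (by nlinarith [hr.2]), mul_sub]
      exact (hasDerivAt_sectorPoly β r).sub (hasDerivAt_sectorCorrection hr.1)

lemma integral_mul_arcIntegral_of_le_mul_cos {β k : ℝ} (hβ₀ : 0 ≤ β) (hβ : β < π / 2)
    (hk : 1 ≤ k * cos β) :
    ∫ r in (0 : ℝ)..k, r * arcIntegral β r = tan β / 12 := by
  have hcont : Continuous fun r => r * arcIntegral β r :=
    continuous_id.mul (continuous_arcIntegral β)
  have hcos : 0 < cos β := cos_pos_of_mem_Ioo ⟨by linarith [pi_pos], hβ⟩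
  have hle : 1 / cos β ≤ k := (div_le_iff₀ hcos).2 hk
  have h0 : 0 < 1 / cos β := one_div_pos.2 hcos
  have hzero : ∫ r in (1 / cos β)..k, r * arcIntegral β r = 0 := by
    rw [intervalIntegral.integral_congr (g := fun _ => 0), intervalIntegral.integral_zero]
    intro r hr
    rw [Set.uIcc_of_le hle] at hr
    beta_reduce
    rw [arcIntegral_eq_zero hβ₀ (by linarith [pi_pos]) (h0.le.trans hr.1)
      ((div_le_iff₀ hcos).1 hr.1), mul_zero]
  rw [← intervalIntegral.integral_add_adjacent_intervals (hcont.intervalIntegrable 0 (1 / cos β))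
    (hcont.intervalIntegrable _ k), hzero, integral_mul_arcIntegral_of_mul_cos_le hβ₀ hβ.le h0.le
    (by field_simp; rfl), add_zero]
  have hs : 0 ≤ sin β := sin_nonneg_of_nonneg_of_le_pi hβ₀ (by linarith [pi_pos])
  have hsqrt : √((1 / cos β) ^ 2 - 1) = sin β / cos β := by
    rw [← sqrt_sq (div_nonneg hs hcos.le), div_pow, div_pow, sin_sq]
    congr 1
    field_simp
  rw [sectorPoly, sectorCorrection, hsqrt, one_div_one_div, arccos_cos hβ₀ (by linarith [pi_pos]),
    tan_eq_sin_div_cos]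
  have e := sin_sq_add_cos_sq β
  field_simp
  grind

/-- The proportion of the right triangle with legs `a` and `b` along the axes that remains covered
after translating the triangle by the vector `(x, y)`. -/
noncomputable def overlap (a b x y : ℝ) : ℝ :=
  (max 0 (1 - max (max |x / a| |y / b|) |x / a + y / b|)) ^ 2

lemma overlap_neg (a b x y : ℝ) : overlap a b (-x) (-y) = overlap a b x y := by
  simp only [overlap, neg_div, abs_neg, ← neg_add]

lemma overlap_nonneg (a b x y : ℝ) : 0 ≤ overlap a b x y := sq_nonneg _

lemma continuous_overlap (a b : ℝ) : Continuous fun p : ℝ × ℝ => overlap a b p.1 p.2 := by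
  unfold overlap
  fun_prop

lemma cos_div_add_sin_div {a b h α : ℝ} (ha : 0 < a) (hb : 0 < b) (hh : 0 < h)
    (hcos : cos α = h / a) (hsin : sin α = h / b) (r θ : ℝ) :
    r * cos θ / a + r * sin θ / b = r / h * cos (θ - α) := by
  rw [cos_sub, hcos, hsin]
  field_simp

lemma overlap_polar_of_le_pi_div_two {a b h α r θ : ℝ} (ha : 0 < a) (hb : 0 < b) (hh : 0 < h)
    (hcos : cos α = h / a) (hsin : sin α = h / b) (hr : 0 ≤ r) (hθ₀ : 0 ≤ θ) (hθ : θ ≤ π / 2) :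
    overlap a b (r * cos θ) (r * sin θ) = (max 0 (1 - r / h * cos (θ - α))) ^ 2 := by
  have hc : 0 ≤ r * cos θ / a :=
    div_nonneg (mul_nonneg hr (cos_nonneg_of_neg_pi_div_two_le_of_le (by linarith [pi_pos]) hθ))
      ha.le
  have hs : 0 ≤ r * sin θ / b :=
    div_nonneg (mul_nonneg hr (sin_nonneg_of_nonneg_of_le_pi hθ₀ (by linarith [pi_pos]))) hb.le
  rw [← cos_div_add_sin_div ha hb hh hcos hsin, overlap, abs_of_nonneg hc, abs_of_nonneg hs,
    abs_of_nonneg (add_nonneg hc hs),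
    max_eq_right (max_le (le_add_of_nonneg_right hs) (le_add_of_nonneg_left hc))]

lemma overlap_polar_of_le_pi_div_two_add {a b h α r θ : ℝ} (ha : 0 < a) (hb : 0 < b) (hh : 0 < h)
    (hcos : cos α = h / a) (hsin : sin α = h / b) (hα : α ≤ π / 2) (hr : 0 ≤ r)
    (hθ₀ : π / 2 ≤ θ) (hθ : θ ≤ π / 2 + α) :
    overlap a b (r * cos θ) (r * sin θ) = (max 0 (1 - r / b * cos (θ - π / 2))) ^ 2 := by
  have hc : r * cos θ / a ≤ 0 := div_nonpos_of_nonpos_of_nonneg (mul_nonpos_of_nonneg_of_nonpos hr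
    (cos_nonpos_of_pi_div_two_le_of_le hθ₀ (by linarith [pi_pos]))) ha.le
  have hs : 0 ≤ r * sin θ / b :=
    div_nonneg (mul_nonneg hr (sin_nonneg_of_nonneg_of_le_pi (by linarith [pi_pos])
      (by linarith [pi_pos]))) hb.le
  have hsum : 0 ≤ r * cos θ / a + r * sin θ / b := by
    rw [cos_div_add_sin_div ha hb hh hcos hsin]
    exact mul_nonneg (div_nonneg hr hh.le)
      (cos_nonneg_of_neg_pi_div_two_le_of_le (by linarith [pi_pos]) (by linarith))
  rw [overlap, abs_of_nonpos hc, abs_of_nonneg hs, abs_of_nonneg hsum,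
    max_eq_right (a := -(r * cos θ / a)) (by linarith),
    max_eq_left (b := r * cos θ / a + r * sin θ / b) (by linarith), cos_sub_pi_div_two]
  congr 3
  ring

lemma overlap_polar_of_le_pi {a b h α r θ : ℝ} (ha : 0 < a) (hb : 0 < b) (hh : 0 < h)
    (hcos : cos α = h / a) (hsin : sin α = h / b) (hα₀ : 0 ≤ α) (hr : 0 ≤ r)
    (hθ₀ : π / 2 + α ≤ θ) (hθ : θ ≤ π) :
    overlap a b (r * cos θ) (r * sin θ) = (max 0 (1 - r / a * cos (π - θ))) ^ 2 := by
  have hc : r * cos θ / a ≤ 0 := div_nonpos_of_nonpos_of_nonneg (mul_nonpos_of_nonneg_of_nonpos hr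
    (cos_nonpos_of_pi_div_two_le_of_le (by linarith) (by linarith [pi_pos]))) ha.le
  have hs : 0 ≤ r * sin θ / b :=
    div_nonneg (mul_nonneg hr (sin_nonneg_of_nonneg_of_le_pi (by linarith [pi_pos]) hθ)) hb.le
  have hsum : r * cos θ / a + r * sin θ / b ≤ 0 := by
    rw [cos_div_add_sin_div ha hb hh hcos hsin]
    exact mul_nonpos_of_nonneg_of_nonpos (div_nonneg hr hh.le)
      (cos_nonpos_of_pi_div_two_le_of_le (by linarith) (by linarith))
  rw [overlap, abs_of_nonpos hc, abs_of_nonneg hs, abs_of_nonpos hsum,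
    max_eq_left (a := -(r * cos θ / a)) (by linarith),
    max_eq_left (b := -(r * cos θ / a + r * sin θ / b)) (by linarith), cos_pi_sub]
  congr 3
  ring

lemma integral_overlap_polar {a b h α r : ℝ} (ha : 0 < a) (hb : 0 < b) (hh : 0 < h)
    (hcos : cos α = h / a) (hsin : sin α = h / b) (hα₀ : 0 ≤ α) (hα : α ≤ π / 2) (hr : 0 ≤ r) :
    ∫ θ in (-π)..π, overlap a b (r * cos θ) (r * sin θ) =
      2 * (arcIntegral α (r / h) + arcIntegral (π / 2 - α) (r / h) + arcIntegral (π / 2 - α) (r / a)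
        + arcIntegral α (r / b)) := by
  have hcont : Continuous fun θ => overlap a b (r * cos θ) (r * sin θ) :=
    (continuous_overlap a b).comp (f := fun θ => (r * cos θ, r * sin θ)) (by fun_prop)
  have hint := fun x y => hcont.intervalIntegrable (μ := volume) x y
  have hper : ∫ θ in (-π)..0, overlap a b (r * cos θ) (r * sin θ) =
      ∫ θ in (0 : ℝ)..π, overlap a b (r * cos θ) (r * sin θ) := by
    have := intervalIntegral.integral_comp_add_right (a := -π) (b := 0)
      (fun θ => overlap a b (r * cos θ) (r * sin θ)) π
    simpa only [cos_add_pi, sin_add_pi, mul_neg, overlap_neg, neg_add_cancel, zero_add] using this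
  have h₁ : ∫ θ in (0 : ℝ)..α, overlap a b (r * cos θ) (r * sin θ) = arcIntegral α (r / h) := by
    have := intervalIntegral.integral_comp_sub_left (a := 0) (b := α)
      (fun φ => (max 0 (1 - r / h * cos φ)) ^ 2) α
    rw [sub_self, sub_zero] at this
    rw [arcIntegral, ← this]
    refine intervalIntegral.integral_congr fun θ hθ => ?_
    rw [Set.uIcc_of_le hα₀] at hθ
    rw [overlap_polar_of_le_pi_div_two ha hb hh hcos hsin hr hθ.1 (hθ.2.trans hα), ← cos_neg,
      neg_sub]
  have h₂ : ∫ θ in α..(π / 2), overlap a b (r * cos θ) (r * sin θ) =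
      arcIntegral (π / 2 - α) (r / h) := by
    have := intervalIntegral.integral_comp_sub_right (a := α) (b := π / 2)
      (fun φ => (max 0 (1 - r / h * cos φ)) ^ 2) α
    rw [sub_self] at this
    rw [arcIntegral, ← this]
    refine intervalIntegral.integral_congr fun θ hθ => ?_
    rw [Set.uIcc_of_le hα] at hθ
    exact overlap_polar_of_le_pi_div_two ha hb hh hcos hsin hr (hα₀.trans hθ.1) hθ.2
  have h₃ : ∫ θ in (π / 2)..(π / 2 + α), overlap a b (r * cos θ) (r * sin θ) =
      arcIntegral α (r / b) := by
    have := intervalIntegral.integral_comp_sub_right (a := π / 2) (b := π / 2 + α)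
      (fun φ => (max 0 (1 - r / b * cos φ)) ^ 2) (π / 2)
    rw [sub_self, add_sub_cancel_left] at this
    rw [arcIntegral, ← this]
    refine intervalIntegral.integral_congr fun θ hθ => ?_
    rw [Set.uIcc_of_le (by linarith)] at hθ
    exact overlap_polar_of_le_pi_div_two_add ha hb hh hcos hsin hα hr hθ.1 hθ.2
  have h₄ : ∫ θ in (π / 2 + α)..π, overlap a b (r * cos θ) (r * sin θ) =
      arcIntegral (π / 2 - α) (r / a) := by
    have := intervalIntegral.integral_comp_sub_left (a := π / 2 + α) (b := π)
      (fun φ => (max 0 (1 - r / a * cos φ)) ^ 2) π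
    rw [sub_self, show π - (π / 2 + α) = π / 2 - α by ring] at this
    rw [arcIntegral, ← this]
    refine intervalIntegral.integral_congr fun θ hθ => ?_
    rw [Set.uIcc_of_le (by linarith)] at hθ
    exact overlap_polar_of_le_pi ha hb hh hcos hsin hα₀ hr hθ.1 hθ.2
  rw [← intervalIntegral.integral_add_adjacent_intervals (hint (-π) 0) (hint 0 π), hper,
    ← intervalIntegral.integral_add_adjacent_intervals (hint 0 α) (hint α π),
    ← intervalIntegral.integral_add_adjacent_intervals (hint α (π / 2)) (hint (π / 2) π),
    ← intervalIntegral.integral_add_adjacent_intervals (hint (π / 2) (π / 2 + α)) (hint _ π),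
    h₁, h₂, h₃, h₄]
  ring

lemma isClosed_triangle (a b x₀ y₀ k : ℝ) :
    IsClosed {q : ℝ × ℝ | x₀ ≤ q.1 ∧ y₀ ≤ q.2 ∧ b * q.1 + a * q.2 ≤ k} := by
  simp only [Set.ofPred_and]
  exact (isClosed_le (by fun_prop) (by fun_prop)).inter ((isClosed_le (by fun_prop)
    (by fun_prop)).inter (isClosed_le (by fun_prop) (by fun_prop)))

lemma volume_triangle {a b : ℝ} (ha : 0 < a) (hb : 0 < b) (x₀ y₀ k : ℝ) :
    volume {q : ℝ × ℝ | x₀ ≤ q.1 ∧ y₀ ≤ q.2 ∧ b * q.1 + a * q.2 ≤ k} =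
      ENNReal.ofReal ((max 0 (k - b * x₀ - a * y₀)) ^ 2 / (2 * a * b)) := by
  have hm : MeasurableSet {q : ℝ × ℝ | x₀ ≤ q.1 ∧ y₀ ≤ q.2 ∧ b * q.1 + a * q.2 ≤ k} :=
    (isClosed_triangle a b x₀ y₀ k).measurableSet
  set x₁ := (k - a * y₀) / b with hx₁
  have hk : k = b * x₁ + a * y₀ := by
    rw [hx₁]
    field_simp
    ring
  have hslice : ∀ x, volume (Prod.mk x ⁻¹' {q : ℝ × ℝ | x₀ ≤ q.1 ∧ y₀ ≤ q.2 ∧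
      b * q.1 + a * q.2 ≤ k}) =
      (Set.Icc x₀ x₁).indicator (fun x => ENNReal.ofReal (b / a * (x₁ - x))) x := by
    intro x
    by_cases hx : x ∈ Set.Icc x₀ x₁
    · rw [Set.indicator_of_mem hx]
      have : Prod.mk x ⁻¹' {q : ℝ × ℝ | x₀ ≤ q.1 ∧ y₀ ≤ q.2 ∧ b * q.1 + a * q.2 ≤ k} =
          Set.Icc y₀ ((k - b * x) / a) := by
        ext y
        simp only [Set.mem_preimage, Set.mem_ofPred_eq, Set.mem_Icc, le_div_iff₀ ha]
        constructor
        · rintro ⟨-, h1, h2⟩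
          exact ⟨h1, by linarith⟩
        · rintro ⟨h1, h2⟩
          exact ⟨hx.1, h1, by linarith⟩
      rw [this, Real.volume_Icc, hk]
      congr 1
      field_simp
      ring
    · rw [Set.indicator_of_notMem hx]
      have : Prod.mk x ⁻¹' {q : ℝ × ℝ | x₀ ≤ q.1 ∧ y₀ ≤ q.2 ∧ b * q.1 + a * q.2 ≤ k} = ∅ := by
        ext y
        simp only [Set.mem_preimage, Set.mem_ofPred_eq, Set.mem_empty_iff_false, iff_false]
        rintro ⟨h0, h1, h2⟩
        refine hx ⟨h0, ?_⟩
        rw [hx₁, le_div_iff₀ hb]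
        nlinarith
      rw [this, measure_empty]
  rw [Measure.volume_eq_prod, Measure.prod_apply hm]
  simp_rw [hslice]
  rw [lintegral_indicator measurableSet_Icc]
  rcases lt_or_ge x₁ x₀ with hlt | hle
  · rw [Set.Icc_eq_empty hlt.not_ge, Measure.restrict_empty, lintegral_zero_measure,
      max_eq_left (by rw [hk]; nlinarith)]
    simp
  · have hc : Continuous fun x => b / a * (x₁ - x) := by fun_prop
    rw [← restrict_Ioc_eq_restrict_Icc, ← ofReal_integral_eq_lintegral_ofReal,
      ← intervalIntegral.integral_of_le hle]
    · congr 1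
      rw [max_eq_right (by rw [hk]; nlinarith), intervalIntegral.integral_const_mul,
        intervalIntegral.integral_sub (by simp) (by simp), intervalIntegral.integral_const,
        integral_id, hk]
      simp only [smul_eq_mul]
      field_simp
      ring
    · exact (hc.integrableOn_Icc (a := x₀) (b := x₁)).mono_set Set.Ioc_subset_Icc_self
    · refine (ae_restrict_iff' measurableSet_Ioc).2 (Filter.Eventually.of_forall fun x hx => ?_)
      exact mul_nonneg (div_nonneg hb.le ha.le) (sub_nonneg.2 hx.2)

/-- The right triangle with legs `a` and `b` along the coordinate axes. -/
def legTriangle (a b : ℝ) : Set (ℝ × ℝ) := {q | 0 ≤ q.1 ∧ 0 ≤ q.2 ∧ b * q.1 + a * q.2 ≤ a * b}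

lemma isClosed_legTriangle (a b : ℝ) : IsClosed (legTriangle a b) :=
  isClosed_triangle a b 0 0 (a * b)

lemma volume_legTriangle {a b : ℝ} (ha : 0 < a) (hb : 0 < b) :
    volume (legTriangle a b) = ENNReal.ofReal (a * b / 2) := by
  rw [legTriangle, volume_triangle ha hb,
    max_eq_right (by simp only [mul_zero, sub_zero]; positivity)]
  congr 1
  field_simp
  ring

lemma max_zero_add_max_zero_neg (p q : ℝ) :
    max 0 (p + q) + max 0 (-p) + max 0 (-q) = max (max |p| |q|) |p + q| := by
  rcases abs_cases p with hp | hp <;> rcases abs_cases q with hq | hq <;>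
    rcases abs_cases (p + q) with hpq | hpq <;> grind

lemma volume_legTriangle_inter_translate {a b : ℝ} (ha : 0 < a) (hb : 0 < b) (v : ℝ × ℝ) :
    volume {q | q ∈ legTriangle a b ∧ q + v ∈ legTriangle a b} =
      ENNReal.ofReal (a * b / 2 * overlap a b v.1 v.2) := by
  have hset : {q | q ∈ legTriangle a b ∧ q + v ∈ legTriangle a b} =
      {q : ℝ × ℝ | max 0 (-v.1) ≤ q.1 ∧ max 0 (-v.2) ≤ q.2 ∧
        b * q.1 + a * q.2 ≤ a * b - max 0 (b * v.1 + a * v.2)} := by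
    ext q
    simp only [legTriangle, Set.mem_ofPred_eq, Prod.fst_add, Prod.snd_add, max_le_iff,
      le_sub_comm (a := b * q.1 + a * q.2)]
    constructor
    · rintro ⟨⟨h1, h2, h3⟩, h4, h5, h6⟩
      refine ⟨⟨h1, ?_⟩, ⟨h2, ?_⟩, ?_, ?_⟩ <;> linarith
    · rintro ⟨⟨h1, h2⟩, ⟨h3, h4⟩, h5, h6⟩
      refine ⟨⟨h1, h3, ?_⟩, ?_, ?_, ?_⟩ <;> linarith
  have hN : a * b - max 0 (b * v.1 + a * v.2) - b * max 0 (-v.1) - a * max 0 (-v.2) =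
      a * b * (1 - max (max |v.1 / a| |v.2 / b|) |v.1 / a + v.2 / b|) := by
    obtain ⟨p, hp⟩ : ∃ p, v.1 = a * p := ⟨v.1 / a, by field_simp⟩
    obtain ⟨q, hq⟩ : ∃ q, v.2 = b * q := ⟨v.2 / b, by field_simp⟩
    have h1 : max 0 (b * (a * p) + a * (b * q)) = a * b * max 0 (p + q) := by
      rw [mul_max_of_nonneg _ _ (by positivity)]
      congr 1 <;> ring
    have h2 : b * max 0 (-(a * p)) = a * b * max 0 (-p) := by
      rw [mul_max_of_nonneg _ _ hb.le, mul_max_of_nonneg _ _ (by positivity)]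
      congr 1 <;> ring
    have h3 : a * max 0 (-(b * q)) = a * b * max 0 (-q) := by
      rw [mul_max_of_nonneg _ _ ha.le, mul_max_of_nonneg _ _ (by positivity)]
      congr 1 <;> ring
    rw [hp, hq, h1, h2, h3, mul_div_cancel_left₀ _ ha.ne', mul_div_cancel_left₀ _ hb.ne',
      ← max_zero_add_max_zero_neg]
    ring
  have hab : 0 < a * b := by positivity
  rw [hset, volume_triangle ha hb, hN, overlap,
    show (0 : ℝ) = a * b * 0 by ring, ← mul_max_of_nonneg _ _ hab.le]
  congr 1
  simp only [mul_zero]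
  field_simp

/-- The pairs of points of the triangle whose difference lies in `D`. -/
def trianglePairs (a b : ℝ) (D : Set (ℝ × ℝ)) : Set ((ℝ × ℝ) × (ℝ × ℝ)) :=
  {z | z.1 ∈ legTriangle a b ∧ z.2 ∈ legTriangle a b ∧ z.2 - z.1 ∈ D}

lemma measurableSet_trianglePairs (a b : ℝ) {D : Set (ℝ × ℝ)} (hD : MeasurableSet D) :
    MeasurableSet (trianglePairs a b D) := by
  have hT := (isClosed_legTriangle a b).measurableSet
  exact (hT.preimage measurable_fst).inter ((hT.preimage measurable_snd).inter
    (hD.preimage (measurable_snd.sub measurable_fst)))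

lemma volume_trianglePairs {a b : ℝ} (ha : 0 < a) (hb : 0 < b) {D : Set (ℝ × ℝ)}
    (hD : MeasurableSet D) :
    volume (trianglePairs a b D) = ∫⁻ v in D, ENNReal.ofReal (a * b / 2 * overlap a b v.1 v.2) := by
  have hm := measurableSet_trianglePairs a b hD
  have hshear := measurePreserving_prod_add (volume : Measure (ℝ × ℝ)) (volume : Measure (ℝ × ℝ))
  rw [Measure.volume_eq_prod (ℝ × ℝ) (ℝ × ℝ), ← hshear.measure_preimage hm.nullMeasurableSet,
    Measure.prod_apply_symm (hshear.measurable hm), ← lintegral_indicator hD]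
  refine lintegral_congr fun v => ?_
  have hpre : (fun q => (q, v)) ⁻¹' ((fun z : (ℝ × ℝ) × (ℝ × ℝ) => (z.1, z.1 + z.2)) ⁻¹'
      trianglePairs a b D) = {q | (q ∈ legTriangle a b ∧ q + v ∈ legTriangle a b) ∧ v ∈ D} := by
    ext q
    simp [trianglePairs, and_assoc]
  rw [hpre]
  by_cases hv : v ∈ D
  · simp only [hv, and_true, Set.indicator_of_mem, volume_legTriangle_inter_translate ha hb]
  · simp [hv]

lemma lintegral_disk_polar {f : ℝ × ℝ → ℝ} (hf : Continuous f) (hf₀ : ∀ p, 0 ≤ f p) {t : ℝ}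
    (ht : 0 ≤ t) :
    ∫⁻ v in {v : ℝ × ℝ | v.1 ^ 2 + v.2 ^ 2 ≤ t ^ 2}, ENNReal.ofReal (f v) =
      ENNReal.ofReal (∫ r in (0 : ℝ)..t, r * ∫ θ in (-π)..π, f (r * cos θ, r * sin θ)) := by
  have hD : MeasurableSet {v : ℝ × ℝ | v.1 ^ 2 + v.2 ^ 2 ≤ t ^ 2} :=
    (isClosed_le (by fun_prop) (by fun_prop)).measurableSet
  have hpolar : Continuous fun p : ℝ × ℝ => f (p.1 * cos p.2, p.1 * sin p.2) :=
    hf.comp (f := fun p : ℝ × ℝ => (p.1 * cos p.2, p.1 * sin p.2)) (by fun_prop)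
  have hg : Measurable fun p : ℝ × ℝ => (Set.Iic t ×ˢ Set.univ).indicator
      (fun p => ENNReal.ofReal p.1 * ENNReal.ofReal (f (p.1 * cos p.2, p.1 * sin p.2))) p :=
    ((measurable_fst.ennreal_ofReal).mul hpolar.measurable.ennreal_ofReal).indicator
      (measurableSet_Iic.prod MeasurableSet.univ)
  have hint : Continuous fun r => ∫ θ in (-π)..π, f (r * cos θ, r * sin θ) :=
    intervalIntegral.continuous_parametric_intervalIntegral_of_continuous' hpolar _ _
  have hint₀ : ∀ r, 0 ≤ ∫ θ in (-π)..π, f (r * cos θ, r * sin θ) := fun r =>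
    intervalIntegral.integral_nonneg (by linarith [pi_pos]) fun θ _ => hf₀ _
  have hangle : ∀ r, ∫⁻ θ in Set.Ioo (-π) π, ENNReal.ofReal (f (r * cos θ, r * sin θ)) =
      ENNReal.ofReal (∫ θ in (-π)..π, f (r * cos θ, r * sin θ)) := by
    intro r
    have hc : Continuous fun θ => f (r * cos θ, r * sin θ) := by fun_prop
    rw [intervalIntegral.integral_of_le (by linarith [pi_pos]), integral_Ioc_eq_integral_Ioo,
      ofReal_integral_eq_lintegral_ofReal
        ((hc.integrableOn_Icc (a := -π) (b := π)).mono_set Set.Ioo_subset_Icc_self)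
        (Filter.Eventually.of_forall fun θ => hf₀ _)]
  calc ∫⁻ v in {v : ℝ × ℝ | v.1 ^ 2 + v.2 ^ 2 ≤ t ^ 2}, ENNReal.ofReal (f v)
      = ∫⁻ p in polarCoord.target, (Set.Iic t ×ˢ Set.univ).indicator
        (fun p => ENNReal.ofReal p.1 * ENNReal.ofReal (f (p.1 * cos p.2, p.1 * sin p.2))) p := by
        rw [← lintegral_indicator hD, ← lintegral_comp_polarCoord_symm]
        refine setLIntegral_congr_fun polarCoord.open_target.measurableSet fun p hp => ?_
        have hp0 : 0 < p.1 := hp.1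
        have hiff : (p.1 * cos p.2) ^ 2 + (p.1 * sin p.2) ^ 2 ≤ t ^ 2 ↔ p.1 ≤ t := by
          rw [← sq_le_sq₀ hp0.le ht]
          have : (p.1 * cos p.2) ^ 2 + (p.1 * sin p.2) ^ 2 = p.1 ^ 2 := by
            linear_combination p.1 ^ 2 * sin_sq_add_cos_sq p.2
          rw [this]
        simp only [polarCoord_symm_apply, Set.indicator_apply, Set.mem_ofPred_eq, hiff,
          Set.mem_prod, Set.mem_Iic, Set.mem_univ, and_true, smul_eq_mul, mul_ite, mul_zero]
    _ = ∫⁻ r in Set.Ioi 0, ∫⁻ θ in Set.Ioo (-π) π, (Set.Iic t ×ˢ Set.univ).indicator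
        (fun p => ENNReal.ofReal p.1 *
          ENNReal.ofReal (f (p.1 * cos p.2, p.1 * sin p.2))) (r, θ) := by
        rw [polarCoord_target, Measure.volume_eq_prod, ← Measure.prod_restrict,
          lintegral_prod _ hg.aemeasurable]
    _ = ∫⁻ r in Set.Ioi 0, (Set.Iic t).indicator (fun r => ENNReal.ofReal
        (r * ∫ θ in (-π)..π, f (r * cos θ, r * sin θ))) r := by
        refine setLIntegral_congr_fun measurableSet_Ioi fun r hr => ?_
        by_cases hrt : r ≤ t
        · simp only [Set.indicator_apply, Set.mem_prod, Set.mem_Iic, Set.mem_univ, and_true, hrt,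
            if_true]
          rw [lintegral_const_mul' _ _ ENNReal.ofReal_ne_top, hangle,
            ENNReal.ofReal_mul (le_of_lt hr)]
        · simp [hrt]
    _ = _ := by
        rw [lintegral_indicator measurableSet_Iic, Measure.restrict_restrict measurableSet_Iic,
          Set.inter_comm, Set.Ioi_inter_Iic, intervalIntegral.integral_of_le ht,
          ofReal_integral_eq_lintegral_ofReal]
        · exact ((continuous_id.mul hint).integrableOn_Icc).mono_set Set.Ioc_subset_Icc_self
        · refine (ae_restrict_iff' measurableSet_Ioc).2 (Filter.Eventually.of_forall fun r hr => ?_)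
          exact mul_nonneg hr.1.le (hint₀ r)

/-- The integral of `(1 - x / p)₊ ^ 2` over a circular sector of radius `t` and angle `β`. -/
noncomputable def sectorIntegral (p β t : ℝ) : ℝ :=
  p ^ 2 * ∫ k in (0 : ℝ)..(t / p), k * arcIntegral β k

lemma integral_mul_arcIntegral_div {p : ℝ} (hp : 0 < p) (β t : ℝ) :
    ∫ r in (0 : ℝ)..t, r * arcIntegral β (r / p) = sectorIntegral p β t := by
  have h := intervalIntegral.integral_comp_div (a := 0) (b := t)
    (fun k => k * arcIntegral β k) hp.ne'
  rw [zero_div, smul_eq_mul] at h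
  rw [sectorIntegral, sq, mul_assoc, ← h, ← intervalIntegral.integral_const_mul]
  congr 1
  ext r
  field_simp

lemma volume_trianglePairs_disk {a b h α t : ℝ} (ha : 0 < a) (hb : 0 < b) (hh : 0 < h)
    (hcos : cos α = h / a) (hsin : sin α = h / b) (hα₀ : 0 ≤ α) (hα : α ≤ π / 2) (ht : 0 ≤ t) :
    volume (trianglePairs a b {v | v.1 ^ 2 + v.2 ^ 2 ≤ t ^ 2}) =
      ENNReal.ofReal (a * b * (sectorIntegral h α t + sectorIntegral h (π / 2 - α) t
        + sectorIntegral a (π / 2 - α) t + sectorIntegral b α t)) := by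
  have hi : ∀ β p : ℝ, IntervalIntegrable (fun r => r * arcIntegral β (r / p)) volume 0 t :=
    fun β p => (continuous_id.mul ((continuous_arcIntegral β).comp
      (continuous_id.div_const p))).intervalIntegrable _ _
  rw [volume_trianglePairs ha hb (isClosed_le (by fun_prop) (by fun_prop)).measurableSet,
    lintegral_disk_polar ((continuous_overlap a b).const_mul _)
      (fun p => mul_nonneg (by positivity) (overlap_nonneg _ _ _ _)) ht,
    ← integral_mul_arcIntegral_div hh, ← integral_mul_arcIntegral_div hh,
    ← integral_mul_arcIntegral_div ha, ← integral_mul_arcIntegral_div hb,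
    ← intervalIntegral.integral_add (hi _ _) (hi _ _),
    ← intervalIntegral.integral_add ((hi _ _).add (hi _ _)) (hi _ _),
    ← intervalIntegral.integral_add (((hi _ _).add (hi _ _)).add (hi _ _)) (hi _ _),
    ← intervalIntegral.integral_const_mul]
  congr 1
  refine intervalIntegral.integral_congr fun r hr => ?_
  rw [Set.uIcc_of_le ht] at hr
  rw [intervalIntegral.integral_const_mul, integral_overlap_polar ha hb hh hcos hsin hα₀ hα hr.1]
  ring

lemma volume_trianglePairs_univ {a b : ℝ} (ha : 0 < a) (hb : 0 < b) :
    volume (trianglePairs a b Set.univ) = ENNReal.ofReal ((a * b / 2) ^ 2) := by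
  have : trianglePairs a b Set.univ = legTriangle a b ×ˢ legTriangle a b := by
    ext z
    simp [trianglePairs]
  rw [this, Measure.volume_eq_prod, Measure.prod_prod, volume_legTriangle ha hb,
    ← ENNReal.ofReal_mul (by positivity), sq]

lemma trianglePairs_disk_eq_univ {a b t : ℝ} (ha : 0 < a) (hb : 0 < b)
    (ht : a ^ 2 + b ^ 2 ≤ t ^ 2) :
    trianglePairs a b {v | v.1 ^ 2 + v.2 ^ 2 ≤ t ^ 2} = trianglePairs a b Set.univ := by
  ext ⟨p, q⟩
  simp only [trianglePairs, legTriangle, Set.mem_ofPred_eq, Set.mem_univ, Prod.fst_sub,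
    Prod.snd_sub, and_true, and_congr_right_iff, and_iff_left_iff_imp]
  rintro ⟨p₁, p₂, hp⟩ ⟨q₁, q₂, hq⟩
  have hp₁ : p.1 ≤ a := le_of_mul_le_mul_left (by nlinarith) hb
  have hp₂ : p.2 ≤ b := le_of_mul_le_mul_left (by nlinarith) ha
  have hq₁ : q.1 ≤ a := le_of_mul_le_mul_left (by nlinarith) hb
  have hq₂ : q.2 ≤ b := le_of_mul_le_mul_left (by nlinarith) ha
  have h₁ : (q.1 - p.1) ^ 2 ≤ a ^ 2 := sq_le_sq' (by linarith) (by linarith)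
  have h₂ : (q.2 - p.2) ^ 2 ≤ b ^ 2 := sq_le_sq' (by linarith) (by linarith)
  linarith

lemma volume_euclidean_pairs_eq (a b : ℝ) {t : ℝ} (ht : 0 ≤ t) (T : Set (EuclideanSpace ℝ (Fin 2)))
    (hT : T = {P | 0 ≤ P 0 ∧ 0 ≤ P 1 ∧ b * P 0 + a * P 1 ≤ a * b}) :
    volume {PQ : EuclideanSpace ℝ (Fin 2) × EuclideanSpace ℝ (Fin 2) |
      PQ.1 ∈ T ∧ PQ.2 ∈ T ∧ ‖PQ.1 - PQ.2‖ ≤ t} =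
      volume (trianglePairs a b {v | v.1 ^ 2 + v.2 ^ 2 ≤ t ^ 2}) := by
  have he : MeasurePreserving (fun P : EuclideanSpace ℝ (Fin 2) => (P 0, P 1)) volume volume :=
    (volume_preserving_finTwoArrow ℝ).comp (PiLp.volume_preserving_ofLp (Fin 2))
  have hm := measurableSet_trianglePairs a b (D := {v | v.1 ^ 2 + v.2 ^ 2 ≤ t ^ 2})
    (isClosed_le (by fun_prop) (by fun_prop)).measurableSet
  rw [Measure.volume_eq_prod (ℝ × ℝ), Measure.volume_eq_prod (EuclideanSpace ℝ (Fin 2)),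
    ← (he.prod he).measure_preimage hm.nullMeasurableSet]
  congr 1
  ext ⟨P, Q⟩
  have hn : ‖P - Q‖ ≤ t ↔ (Q 0 - P 0) ^ 2 + (Q 1 - P 1) ^ 2 ≤ t ^ 2 := by
    rw [EuclideanSpace.norm_eq, sqrt_le_left ht, Fin.sum_univ_two]
    simp only [PiLp.sub_apply, norm_eq_abs, sq_abs]
    rw [sub_sq_comm (P 0), sub_sq_comm (P 1)]
  simp [trianglePairs, legTriangle, hT, hn]

lemma sectorIntegral_of_le_mul_cos {p β t : ℝ} (hp : 0 < p) (hβ₀ : 0 ≤ β) (hβ : β < π / 2)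
    (ht : p ≤ t * cos β) : sectorIntegral p β t = p ^ 2 * tan β / 12 := by
  rw [sectorIntegral, integral_mul_arcIntegral_of_le_mul_cos hβ₀ hβ, mul_div_assoc]
  rw [div_mul_eq_mul_div, one_le_div hp]
  exact ht

lemma sectorIntegral_of_le {p β t : ℝ} (hp : 0 < p) (hβ₀ : 0 ≤ β) (hβ : β ≤ π / 2) (ht₀ : 0 ≤ t)
    (ht : t ≤ p) : sectorIntegral p β t =
      β * t ^ 2 / 2 - 2 / 3 * t ^ 3 * sin β / p + t ^ 4 / (8 * p ^ 2) * (β + sin β * cos β) := by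
  have hk₀ : 0 ≤ t / p := div_nonneg ht₀ hp.le
  have hk : t / p ≤ 1 := (div_le_one hp).2 ht
  rw [sectorIntegral, integral_mul_arcIntegral_of_mul_cos_le hβ₀ hβ hk₀
    (by nlinarith [cos_le_one β]), sectorCorrection_of_le_one hk₀ hk, sectorPoly]
  field_simp
  ring

/-- The part of `sectorIntegral r β t` beyond its polynomial part in the case `r ≤ t`. -/
noncomputable def sectorExcess (r t : ℝ) : ℝ :=
  (t ^ 2 / 2 + t ^ 4 / (8 * r ^ 2)) * arcsin (r / t) + 5 / 8 * r * √(t ^ 2 - r ^ 2)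
    + 13 / 24 * √(t ^ 2 - r ^ 2) ^ 3 / r

lemma sectorIntegral_of_mul_cos_le {p β t : ℝ} (hp : 0 < p) (hβ₀ : 0 ≤ β) (hβ : β ≤ π / 2)
    (ht₀ : 0 ≤ t) (ht : t * cos β ≤ p) : sectorIntegral p β t =
      β * t ^ 2 / 2 - 2 / 3 * t ^ 3 * sin β / p + t ^ 4 / (8 * p ^ 2) * (β + sin β * cos β)
        - (t ^ 2 / 2 + t ^ 4 / (8 * p ^ 2)) * (π / 2) + sectorExcess p t := by
  have hs : √((t / p) ^ 2 - 1) = √(t ^ 2 - p ^ 2) / p := by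
    nth_rw 3 [← sqrt_sq hp.le]
    rw [← sqrt_div' _ (sq_nonneg p)]
    congr 1
    field_simp
  rw [sectorIntegral, integral_mul_arcIntegral_of_mul_cos_le hβ₀ hβ (div_nonneg ht₀ hp.le)
    (by rw [div_mul_eq_mul_div, div_le_one hp]; exact ht), sectorPoly, sectorCorrection, hs,
    one_div_div, arccos, sectorExcess]
  field_simp
  ring

/-- The radial derivative of `sectorExcess`, divided by the radius. -/
noncomputable def arcExcess (r t : ℝ) : ℝ :=
  (1 + t ^ 2 / (2 * r ^ 2)) * arcsin (r / t) + 3 / 2 * √(t ^ 2 - r ^ 2) / r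

lemma sectorExcess_self {r : ℝ} (hr : 0 < r) : sectorExcess r r = 5 * π * r ^ 2 / 16 := by
  rw [sectorExcess, sub_self, sqrt_zero, div_self hr.ne', arcsin_one]
  field_simp
  ring

lemma arcExcess_self {r : ℝ} (hr : 0 < r) : arcExcess r r = 3 * π / 4 := by
  rw [arcExcess, sub_self, sqrt_zero, div_self hr.ne', arcsin_one]
  field_simp
  ring

lemma rpow_three_halves_eq {x : ℝ} (hx : 0 ≤ x) : x ^ ((3 : ℝ) / 2) = √x ^ 3 := by
  rw [sqrt_eq_rpow, ← rpow_mul_natCast hx]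
  norm_num

lemma sqrt_sq_sub_legs_altitude {a b c : ℝ} (ha : 0 < a) (hc : 0 < c)
    (hcc : c ^ 2 = a ^ 2 + b ^ 2) :
    √(a ^ 2 - (a * b / c) ^ 2) = a ^ 2 / c := by
  rw [← sqrt_sq (by positivity : 0 ≤ a ^ 2 / c)]
  congr 1
  field_simp
  linear_combination hcc

lemma sectorExcess_mul_eq {r t : ℝ} (hr : 0 < r) (ht : r ≤ t) :
    (1 / 8 * ((5 * r / 3) * (t ^ 2 - r ^ 2) ^ ((3 : ℝ) / 2) + r ^ 3 * √(t ^ 2 - r ^ 2)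
      + t ^ 4 * arcsin (r / t))) / r + (1 / 3 * (t ^ 2 - r ^ 2) ^ ((3 : ℝ) / 2)
      + r / 2 * (r * √(t ^ 2 - r ^ 2) + t ^ 2 * arcsin (r / t))) = r * sectorExcess r t := by
  rw [rpow_three_halves_eq (by nlinarith), sectorExcess]
  field_simp
  ring

lemma arcExcess_mul_eq {r : ℝ} (hr : 0 < r) (t : ℝ) :
    (1 / 2 * (r * √(t ^ 2 - r ^ 2) + t ^ 2 * arcsin (r / t))) / r
      + (√(t ^ 2 - r ^ 2) + r * arcsin (r / t)) = r * arcExcess r t := by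
  rw [arcExcess]
  field_simp
  ring

lemma sum_sectorPoly_eq {a b c h α t w : ℝ} (ha : 0 < a) (hb : 0 < b) (hc : 0 < c)
    (hcc : c ^ 2 = a ^ 2 + b ^ 2) (hh : h = a * b / c) :
    a * b * (α * t ^ 2 / 2 - 2 / 3 * t ^ 3 * (a / c) / h
        + t ^ 4 / (8 * h ^ 2) * (α + a / c * (b / c))
      + ((w / 2 - α) * t ^ 2 / 2 - 2 / 3 * t ^ 3 * (b / c) / h
        + t ^ 4 / (8 * h ^ 2) * (w / 2 - α + b / c * (a / c)))
      + ((w / 2 - α) * t ^ 2 / 2 - 2 / 3 * t ^ 3 * (b / c) / a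
        + t ^ 4 / (8 * a ^ 2) * (w / 2 - α + b / c * (a / c)))
      + (α * t ^ 2 / 2 - 2 / 3 * t ^ 3 * (a / c) / b
        + t ^ 4 / (8 * b ^ 2) * (α + a / c * (b / c)))) =
    a * b / 2 * w * t ^ 2 - 2 * (a + b + c) / 3 * t ^ 3
      + (a / b * (2 * α + w) + 2 * b / a * (w - α) + 6) * t ^ 4 / 16 := by
  rw [hh]
  field_simp
  grind

lemma sum_sectorIntegral_eq_of_leg_le {a b c h α t w q qa qat pa Θ₁ Θ₂ Θ₄ : ℝ}
    (ha : 0 < a) (hb : 0 < b) (hc : 0 < c)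
    (hcc : c ^ 2 = a ^ 2 + b ^ 2) (hh : h = a * b / c)
    (hΘ₁ : Θ₁ = a / b * (2 * α + w) + 2 * b / a * (w - α) + 6)
    (hΘ₂ : Θ₂ = a / b * (2 * α - w) - 2 * b / a * α + 6)
    (hΘ₄ : Θ₄ = 1 - b / a * α)
    (hqa : qa = (a ^ 2 / 2 + a ^ 4 / (8 * h ^ 2)) * (w / 2 - α)
      + 5 / 8 * h * (a ^ 2 / c) + 13 / 24 * (a ^ 2 / c) ^ 3 / h)
    (hpa : pa = (1 + a ^ 2 / (2 * h ^ 2)) * (w / 2 - α) + 3 / 2 * (a ^ 2 / c) / h) :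
    a * b * (h ^ 2 * (a / b) / 12
      + ((w / 2 - α) * t ^ 2 / 2 - 2 / 3 * t ^ 3 * (b / c) / h
        + t ^ 4 / (8 * h ^ 2) * (w / 2 - α + b / c * (a / c))
        - (t ^ 2 / 2 + t ^ 4 / (8 * h ^ 2)) * (w / 2) + q)
      + ((w / 2 - α) * t ^ 2 / 2 - 2 / 3 * t ^ 3 * (b / c) / a
        + t ^ 4 / (8 * a ^ 2) * (w / 2 - α + b / c * (a / c))
        - (t ^ 2 / 2 + t ^ 4 / (8 * a ^ 2)) * (w / 2) + qat)
      + (α * t ^ 2 / 2 - 2 / 3 * t ^ 3 * (a / c) / b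
        + t ^ 4 / (8 * b ^ 2) * (α + a / c * (b / c)))) =
    a * b / 2 * w * t ^ 2 - 2 * (a + b + c) / 3 * t ^ 3 + 2 * (Θ₁ * h ^ 4 / 32
      + (1 / 2 * (a ^ 2 - h ^ 2) * (Θ₁ * h ^ 2 / 8
          - (Θ₂ * h ^ 2 / 8 + a * b * (3 * w / 4)))
        + (Θ₂ * a ^ 4 / 32 + a * b * qa - (Θ₂ * h ^ 4 / 32 + a * b * (5 * w * h ^ 2 / 16))))
      + (1 / 2 * (t ^ 2 - a ^ 2) * (Θ₁ * h ^ 2 / 8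
          + (Θ₂ * a ^ 2 / 8 + a * b * pa - (Θ₂ * h ^ 2 / 8 + a * b * (3 * w / 4)))
          - (a * a + Θ₄ * a ^ 2 / 2 + a * b / 2 * (pa + 3 * w / 4)))
        + (a * t ^ 3 / 3 + Θ₄ * t ^ 4 / 8 + a * b / 2 * (q + qat)
          - (a * a ^ 3 / 3 + Θ₄ * a ^ 4 / 8
            + a * b / 2 * (qa + 5 * w * a ^ 2 / 16))))) := by
  rw [hqa, hpa, hΘ₁, hΘ₂, hΘ₄, hh]
  field_simp
  grind

lemma sum_sectorIntegral_eq_of_legs_le {a b c h α t w qa qb qab qat qbt pa pb pab : ℝ}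
    {Θ₁ Θ₂ Θ₄ Θ₆ : ℝ} (ha : 0 < a) (hb : 0 < b) (hc : 0 < c)
    (hcc : c ^ 2 = a ^ 2 + b ^ 2) (hh : h = a * b / c)
    (hΘ₁ : Θ₁ = a / b * (2 * α + w) + 2 * b / a * (w - α) + 6)
    (hΘ₂ : Θ₂ = a / b * (2 * α - w) - 2 * b / a * α + 6)
    (hΘ₄ : Θ₄ = 1 - b / a * α)
    (hΘ₆ : Θ₆ = a / b * (2 * α - w) - 2 * b / a * α + 2)
    (hqa : qa = (a ^ 2 / 2 + a ^ 4 / (8 * h ^ 2)) * (w / 2 - α)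
      + 5 / 8 * h * (a ^ 2 / c) + 13 / 24 * (a ^ 2 / c) ^ 3 / h)
    (hpa : pa = (1 + a ^ 2 / (2 * h ^ 2)) * (w / 2 - α) + 3 / 2 * (a ^ 2 / c) / h)
    (hqb : qb = (b ^ 2 / 2 + b ^ 4 / (8 * h ^ 2)) * α
      + 5 / 8 * h * (b ^ 2 / c) + 13 / 24 * (b ^ 2 / c) ^ 3 / h)
    (hpb : pb = (1 + b ^ 2 / (2 * h ^ 2)) * α + 3 / 2 * (b ^ 2 / c) / h) :
    a * b * (h ^ 2 * (a / b) / 12 + h ^ 2 * (b / a) / 12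
      + ((w / 2 - α) * t ^ 2 / 2 - 2 / 3 * t ^ 3 * (b / c) / a
        + t ^ 4 / (8 * a ^ 2) * (w / 2 - α + b / c * (a / c))
        - (t ^ 2 / 2 + t ^ 4 / (8 * a ^ 2)) * (w / 2) + qat)
      + (α * t ^ 2 / 2 - 2 / 3 * t ^ 3 * (a / c) / b
        + t ^ 4 / (8 * b ^ 2) * (α + a / c * (b / c))
        - (t ^ 2 / 2 + t ^ 4 / (8 * b ^ 2)) * (w / 2) + qbt)) =
    a * b / 2 * w * t ^ 2 - 2 * (a + b + c) / 3 * t ^ 3 + 2 * (Θ₁ * h ^ 4 / 32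
      + (1 / 2 * (a ^ 2 - h ^ 2) * (Θ₁ * h ^ 2 / 8
          - (Θ₂ * h ^ 2 / 8 + a * b * (3 * w / 4)))
        + (Θ₂ * a ^ 4 / 32 + a * b * qa - (Θ₂ * h ^ 4 / 32 + a * b * (5 * w * h ^ 2 / 16))))
      + (1 / 2 * (b ^ 2 - a ^ 2) * (Θ₁ * h ^ 2 / 8
          + (Θ₂ * a ^ 2 / 8 + a * b * pa - (Θ₂ * h ^ 2 / 8 + a * b * (3 * w / 4)))
          - (a * a + Θ₄ * a ^ 2 / 2 + a * b / 2 * (pa + 3 * w / 4)))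
        + (a * b ^ 3 / 3 + Θ₄ * b ^ 4 / 8 + a * b / 2 * (qb + qab)
          - (a * a ^ 3 / 3 + Θ₄ * a ^ 4 / 8 + a * b / 2 * (qa + 5 * w * a ^ 2 / 16))))
      + (1 / 2 * (t ^ 2 - b ^ 2) * (Θ₁ * h ^ 2 / 8
          + (Θ₂ * a ^ 2 / 8 + a * b * pa - (Θ₂ * h ^ 2 / 8 + a * b * (3 * w / 4)))
          + (a * b + Θ₄ * b ^ 2 / 2 + a * b / 2 * (pb + pab)
            - (a * a + Θ₄ * a ^ 2 / 2 + a * b / 2 * (pa + 3 * w / 4)))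
          - ((a + b) * b + Θ₆ * b ^ 2 / 8 + a * b / 2 * (pab + 3 * w / 4)))
        + ((a + b) * t ^ 3 / 3 + Θ₆ * t ^ 4 / 32 + a * b / 2 * (qat + qbt)
          - ((a + b) * b ^ 3 / 3 + Θ₆ * b ^ 4 / 32
            + a * b / 2 * (qab + 5 * w * b ^ 2 / 16))))) := by
  rw [hqb, hpb, hqa, hpa, hΘ₁, hΘ₂, hΘ₄, hΘ₆, hh]
  field_simp
  grind

lemma sqrt_one_add_div_sq {a b c : ℝ} (hb : 0 < b) (hc : 0 < c) (hcc : c ^ 2 = a ^ 2 + b ^ 2) :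
    √(1 + (a / b) ^ 2) = c / b := by
  rw [← sqrt_sq (by positivity : 0 ≤ c / b)]
  congr 1
  field_simp
  linear_combination -hcc

lemma sin_arctan_div {a b c : ℝ} (hb : 0 < b) (hc : 0 < c) (hcc : c ^ 2 = a ^ 2 + b ^ 2) :
    sin (arctan (a / b)) = a / c := by
  rw [sin_arctan, sqrt_one_add_div_sq hb hc hcc]
  field_simp

lemma cos_arctan_div {a b c : ℝ} (hb : 0 < b) (hc : 0 < c) (hcc : c ^ 2 = a ^ 2 + b ^ 2) :
    cos (arctan (a / b)) = b / c := by
  rw [cos_arctan, sqrt_one_add_div_sq hb hc hcc]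
  field_simp

set_option maxHeartbeats 400000 in
/-- The distribution function of the distance between two uniform random points
in a right-angled triangle with legs `a ≤ b`. -/
theorem distance_distribution_right_triangle
    (a b c α u A h : ℝ) (ha : 0 < a) (hab : a ≤ b)
    (hc : c = Real.sqrt (a ^ 2 + b ^ 2))
    (hα : α = Real.arctan (a / b))
    (hu : u = a + b + c)
    (hA : A = a * b / 2)
    (hh : h = a * b / c)
    (T : Set (EuclideanSpace ℝ (Fin 2)))
    (hT : T = {P | 0 ≤ P 0 ∧ 0 ≤ P 1 ∧ b * P 0 + a * P 1 ≤ a * b})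
    (Θ₁ Θ₂ Θ₃ Θ₄ Θ₅ Θ₆ : ℝ)
    (hΘ₁ : Θ₁ = (a / b) * (2 * α + π) + (2 * b / a) * (π - α) + 6)
    (hΘ₂ : Θ₂ = (a / b) * (2 * α - π) - (2 * b / a) * α + 6)
    (hΘ₃ : Θ₃ = a / b + b / a)
    (hΘ₄ : Θ₄ = 1 - (b / a) * α)
    (hΘ₅ : Θ₅ = a + b)
    (hΘ₆ : Θ₆ = (a / b) * (2 * α - π) - (2 * b / a) * α + 2)
    (L₁s L₂s L₁d L₂d : ℝ → ℝ → ℝ)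
    (hL₁s : ∀ t r, L₁s t r = (1 / 2) * (r * Real.sqrt (t ^ 2 - r ^ 2)
      + t ^ 2 * Real.arcsin (r / t)))
    (hL₂s : ∀ t r, L₂s t r = Real.sqrt (t ^ 2 - r ^ 2) + r * Real.arcsin (r / t))
    (hL₁d : ∀ t r, L₁d t r = (1 / 8) * ((5 * r / 3) * (t ^ 2 - r ^ 2) ^ ((3:ℝ) / 2)
      + r ^ 3 * Real.sqrt (t ^ 2 - r ^ 2) + t ^ 4 * Real.arcsin (r / t)))
    (hL₂d : ∀ t r, L₂d t r = (1 / 3) * (t ^ 2 - r ^ 2) ^ ((3:ℝ) / 2)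
      + (r / 2) * (r * Real.sqrt (t ^ 2 - r ^ 2) + t ^ 2 * Real.arcsin (r / t)))
    (H₁s H₂s H₃s H₄s H₁d H₂d H₃d H₄d : ℝ → ℝ)
    (hH₁s : ∀ t, H₁s t = Θ₁ * t ^ 2 / 8)
    (hH₂s : ∀ t, H₂s t = Θ₂ * t ^ 2 / 8 + Θ₃ * L₁s t h + c * L₂s t h)
    (hH₃s : ∀ t, H₃s t = a * t + Θ₄ * t ^ 2 / 2 + (Θ₃ / 2) * L₁s t h + (c / 2) * L₂s t h
      + (b / (2 * a)) * L₁s t a + (b / 2) * L₂s t a)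
    (hH₄s : ∀ t, H₄s t = Θ₅ * t + Θ₆ * t ^ 2 / 8 + (b / (2 * a)) * L₁s t a
      + (b / 2) * L₂s t a + (a / (2 * b)) * L₁s t b + (a / 2) * L₂s t b)
    (hH₁d : ∀ t, H₁d t = Θ₁ * t ^ 4 / 32)
    (hH₂d : ∀ t, H₂d t = Θ₂ * t ^ 4 / 32 + Θ₃ * L₁d t h + c * L₂d t h)
    (hH₃d : ∀ t, H₃d t = a * t ^ 3 / 3 + Θ₄ * t ^ 4 / 8 + (Θ₃ / 2) * L₁d t h
      + (c / 2) * L₂d t h + (b / (2 * a)) * L₁d t a + (b / 2) * L₂d t a)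
    (hH₄d : ∀ t, H₄d t = Θ₅ * t ^ 3 / 3 + Θ₆ * t ^ 4 / 32 + (b / (2 * a)) * L₁d t a
      + (b / 2) * L₂d t a + (a / (2 * b)) * L₁d t b + (a / 2) * L₂d t b)
    (K₁ K₂ K₃ K₄ : ℝ → ℝ)
    (hK₁ : ∀ t, K₁ t = H₁d t - H₁d 0)
    (hK₂ : ∀ t, K₂ t = (1 / 2) * (t ^ 2 - h ^ 2) * ((H₁s h - H₁s 0) - H₂s h)
      + (H₂d t - H₂d h))
    (hK₃ : ∀ t, K₃ t = (1 / 2) * (t ^ 2 - a ^ 2) * ((H₁s h - H₁s 0) + (H₂s a - H₂s h)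
      - H₃s a) + (H₃d t - H₃d a))
    (hK₄ : ∀ t, K₄ t = (1 / 2) * (t ^ 2 - b ^ 2) * ((H₁s h - H₁s 0) + (H₂s a - H₂s h)
      + (H₃s b - H₃s a) - H₄s b) + (H₄d t - H₄d b))
    (Jd : ℝ → ℝ)
    (hJd₁ : ∀ t, 0 ≤ t → t < h → Jd t = K₁ t)
    (hJd₂ : ∀ t, h ≤ t → t < a → Jd t = K₁ h + K₂ t)
    (hJd₃ : ∀ t, a ≤ t → t < b → Jd t = K₁ h + K₂ a + K₃ t)
    (hJd₄ : ∀ t, b ≤ t → t < c → Jd t = K₁ h + K₂ a + K₃ b + K₄ t)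
    (G : ℝ → ℝ)
    (hG : ∀ t, G t = (1 / A) * (t ^ 2 * (π - (2 * u / (3 * A)) * t) + (2 / A) * Jd t)) :
    ∀ t : ℝ,
      (0 ≤ t → t < c →
        volume {PQ : EuclideanSpace ℝ (Fin 2) × EuclideanSpace ℝ (Fin 2) |
            PQ.1 ∈ T ∧ PQ.2 ∈ T ∧ ‖PQ.1 - PQ.2‖ ≤ t}
          = ENNReal.ofReal (A ^ 2 * G t)) ∧
      (c ≤ t →
        volume {PQ : EuclideanSpace ℝ (Fin 2) × EuclideanSpace ℝ (Fin 2) |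
            PQ.1 ∈ T ∧ PQ.2 ∈ T ∧ ‖PQ.1 - PQ.2‖ ≤ t}
          = ENNReal.ofReal (A ^ 2)) := by
  have hb : 0 < b := ha.trans_le hab
  have hc₀ : 0 < c := hc ▸ sqrt_pos.2 (by positivity)
  have hcc : c ^ 2 = a ^ 2 + b ^ 2 := by rw [hc, sq_sqrt (by positivity)]
  have hh₀ : 0 < h := hh ▸ by positivity
  have hhc : h * c = a * b := by rw [hh]; field_simp
  have hα₀ : 0 ≤ α := hα ▸ arctan_nonneg.2 (by positivity)
  have hα₁ : α < π / 2 := hα ▸ arctan_lt_pi_div_two _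
  have htan : tan α = a / b := by rw [hα, tan_arctan]
  have hsin : sin α = a / c := by rw [hα, sin_arctan_div hb hc₀ hcc]
  have hcos : cos α = b / c := by rw [hα, cos_arctan_div hb hc₀ hcc]
  have hbc : b < c := lt_of_pow_lt_pow_left₀ 2 hc₀.le (hcc ▸ lt_add_of_pos_left _ (pow_pos ha 2))
  have hha : h < a := by
    rw [hh, div_lt_iff₀ hc₀]
    exact mul_lt_mul_of_pos_left hbc ha
  have hhb : h < b := hha.trans_le hab
  have hsin' : sin (π / 2 - α) = b / c := by rw [sin_pi_div_two_sub, hcos]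
  have hcos' : cos (π / 2 - α) = a / c := by rw [cos_pi_div_two_sub, hsin]
  have htan' : tan (π / 2 - α) = b / a := by rw [tan_pi_div_two_sub, htan, inv_div]
  have hasin_a : arcsin (h / a) = π / 2 - α := by
    rw [show h / a = sin (π / 2 - α) by rw [hsin', hh]; field_simp]
    exact arcsin_sin (by linarith) (by linarith)
  have hasin_b : arcsin (h / b) = α := by
    rw [show h / b = sin α by rw [hsin, hh]; field_simp]
    exact arcsin_sin (by linarith) hα₁.le
  have hsqrt_a : √(a ^ 2 - h ^ 2) = a ^ 2 / c := by
    rw [hh, sqrt_sq_sub_legs_altitude ha hc₀ hcc]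
  have hsqrt_b : √(b ^ 2 - h ^ 2) = b ^ 2 / c := by
    rw [hh, mul_comm a b, sqrt_sq_sub_legs_altitude hb hc₀ (by rw [hcc, add_comm])]
  have hΘc : Θ₃ = c / h := by
    rw [hΘ₃, hh]
    field_simp
    linear_combination -hcc
  have hH₂d' : ∀ t, h ≤ t → H₂d t = Θ₂ * t ^ 4 / 32 + a * b * sectorExcess h t := fun t ht => by
    have e := sectorExcess_mul_eq hh₀ ht
    rw [← hL₁d, ← hL₂d] at e
    rw [hH₂d, hΘc]
    linear_combination c * e + sectorExcess h t * hhc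
  have hH₂s' : ∀ t, H₂s t = Θ₂ * t ^ 2 / 8 + a * b * arcExcess h t := fun t => by
    have e := arcExcess_mul_eq hh₀ t
    rw [← hL₁s, ← hL₂s] at e
    rw [hH₂s, hΘc]
    linear_combination c * e + arcExcess h t * hhc
  have hH₃d' : ∀ t, a ≤ t → H₃d t = a * t ^ 3 / 3 + Θ₄ * t ^ 4 / 8
      + a * b / 2 * (sectorExcess h t + sectorExcess a t) := fun t ht => by
    have e := sectorExcess_mul_eq hh₀ (hha.le.trans ht)
    have e' := sectorExcess_mul_eq ha ht
    rw [← hL₁d, ← hL₂d] at e e'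
    rw [hH₃d, hΘc]
    linear_combination c / 2 * e + sectorExcess h t / 2 * hhc + b / 2 * e'
  have hH₃s' : ∀ t, H₃s t = a * t + Θ₄ * t ^ 2 / 2
      + a * b / 2 * (arcExcess h t + arcExcess a t) := fun t => by
    have e := arcExcess_mul_eq hh₀ t
    have e' := arcExcess_mul_eq ha t
    rw [← hL₁s, ← hL₂s] at e e'
    rw [hH₃s, hΘc]
    linear_combination c / 2 * e + arcExcess h t / 2 * hhc + b / 2 * e'
  have hH₄d' : ∀ t, b ≤ t → H₄d t = (a + b) * t ^ 3 / 3 + Θ₆ * t ^ 4 / 32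
      + a * b / 2 * (sectorExcess a t + sectorExcess b t) := fun t ht => by
    have e := sectorExcess_mul_eq ha (hab.trans ht)
    have e' := sectorExcess_mul_eq hb ht
    rw [← hL₁d, ← hL₂d] at e e'
    rw [hH₄d, hΘ₅]
    linear_combination b / 2 * e + a / 2 * e'
  have hH₄s' : ∀ t, H₄s t = (a + b) * t + Θ₆ * t ^ 2 / 8
      + a * b / 2 * (arcExcess a t + arcExcess b t) := fun t => by
    have e := arcExcess_mul_eq ha t
    have e' := arcExcess_mul_eq hb t
    rw [← hL₁s, ← hL₂s] at e e'
    rw [hH₄s, hΘ₅]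
    linear_combination b / 2 * e + a / 2 * e'
  have hK₁' : ∀ t, K₁ t = Θ₁ * t ^ 4 / 32 := fun t => by
    rw [hK₁, hH₁d, hH₁d]
    ring
  have hJh : H₁s h - H₁s 0 = Θ₁ * h ^ 2 / 8 := by
    rw [hH₁s, hH₁s]
    ring
  refine fun t => ⟨fun ht₀ htc => ?_, fun htc => ?_⟩
  · have hAG : A ^ 2 * G t = A * π * t ^ 2 - 2 * u / 3 * t ^ 3 + 2 * Jd t := by
      have : 0 < A := hA ▸ by positivity
      rw [hG]
      field_simp
    rw [volume_euclidean_pairs_eq a b ht₀ T hT, volume_trianglePairs_disk ha hb hh₀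
      (by rw [hcos, hh]; field_simp) (by rw [hsin, hh]; field_simp) hα₀ hα₁.le ht₀, hAG]
    congr 1
    have hβ₀ : 0 ≤ π / 2 - α := by linarith
    have hβ₁ : π / 2 - α < π / 2 := by
      rw [hα]
      linarith [arctan_pos.2 (by positivity : 0 < a / b)]
    have hpoly := sum_sectorPoly_eq (α := α) (t := t) (w := π) ha hb hc₀ hcc hh
    rw [← hΘ₁, ← hA, ← hu] at hpoly
    rcases lt_or_ge t h with h₁ | h₁
    · rw [hJd₁ t ht₀ h₁, hK₁', sectorIntegral_of_le hh₀ hα₀ hα₁.le ht₀ h₁.le,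
        sectorIntegral_of_le hh₀ hβ₀ hβ₁.le ht₀ h₁.le,
        sectorIntegral_of_le ha hβ₀ hβ₁.le ht₀ (h₁.trans hha).le,
        sectorIntegral_of_le hb hα₀ hα₁.le ht₀ (h₁.trans hhb).le, hsin, hcos, hsin', hcos']
      linear_combination hpoly
    have htβ (htb : t ≤ b) : t * cos (π / 2 - α) ≤ h := by
      rw [hcos', hh, mul_div_assoc', mul_comm]
      gcongr
    rcases lt_or_ge t a with h₂ | h₂
    · have htα : t * cos α ≤ h := by
        rw [hcos, hh, mul_div_assoc']
        gcongr
      have hΘ₁₂ : Θ₁ - Θ₂ = 2 * π * a * b / h ^ 2 := by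
        rw [hΘ₁, hΘ₂, hh]
        field_simp
        linear_combination (-2 * π) * hcc
      have hΘ₁₂' : (Θ₁ - Θ₂) * h ^ 2 = 2 * π * a * b := by
        rw [hΘ₁₂]
        field_simp
      rw [hJd₂ t h₁ h₂, hK₁', hK₂, hJh, hH₂s', hH₂d' t h₁, hH₂d' h le_rfl, arcExcess_self hh₀,
        sectorExcess_self hh₀, sectorIntegral_of_mul_cos_le hh₀ hα₀ hα₁.le ht₀ htα,
        sectorIntegral_of_mul_cos_le hh₀ hβ₀ hβ₁.le ht₀ (htβ (h₂.le.trans hab)),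
        sectorIntegral_of_le ha hβ₀ hβ₁.le ht₀ h₂.le,
        sectorIntegral_of_le hb hα₀ hα₁.le ht₀ (h₂.le.trans hab), hsin, hcos, hsin', hcos']
      linear_combination hpoly + t ^ 4 / 16 * hΘ₁₂ - (h ^ 2 / 16 + (t ^ 2 - h ^ 2) / 8) * hΘ₁₂'
    have htα : h ≤ t * cos α := by
      rw [hcos, hh, mul_div_assoc']
      gcongr
    have htβa : t * cos (π / 2 - α) ≤ a := by
      rw [hcos', mul_div_assoc', div_le_iff₀ hc₀, mul_comm]
      gcongr
    have hqa : sectorExcess h a = (a ^ 2 / 2 + a ^ 4 / (8 * h ^ 2)) * (π / 2 - α)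
        + 5 / 8 * h * (a ^ 2 / c) + 13 / 24 * (a ^ 2 / c) ^ 3 / h := by
      rw [sectorExcess, hasin_a, hsqrt_a]
    have hpa : arcExcess h a = (1 + a ^ 2 / (2 * h ^ 2)) * (π / 2 - α)
        + 3 / 2 * (a ^ 2 / c) / h := by
      rw [arcExcess, hasin_a, hsqrt_a]
    rcases lt_or_ge t b with h₃ | h₃
    · rw [hJd₃ t h₂ h₃, hK₁', hK₂, hK₃, hJh, hH₂s', hH₂s', hH₂d' a hha.le, hH₂d' h le_rfl,
        hH₃s', hH₃d' t h₂, hH₃d' a le_rfl, arcExcess_self hh₀, arcExcess_self ha,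
        sectorExcess_self hh₀, sectorExcess_self ha,
        sectorIntegral_of_le_mul_cos hh₀ hα₀ hα₁ htα,
        sectorIntegral_of_mul_cos_le hh₀ hβ₀ hβ₁.le ht₀ (htβ h₃.le),
        sectorIntegral_of_mul_cos_le ha hβ₀ hβ₁.le ht₀ htβa,
        sectorIntegral_of_le hb hα₀ hα₁.le ht₀ h₃.le, hsin', hcos', hsin, hcos, htan, hA, hu]
      exact sum_sectorIntegral_eq_of_leg_le ha hb hc₀ hcc hh hΘ₁ hΘ₂ hΘ₄ hqa hpa
    have htβ' : h ≤ t * cos (π / 2 - α) := by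
      rw [hcos', hh, mul_div_assoc', mul_comm a b]
      gcongr
    have htαb : t * cos α ≤ b := by
      rw [hcos, mul_div_assoc', div_le_iff₀ hc₀, mul_comm]
      gcongr
    have hqb : sectorExcess h b = (b ^ 2 / 2 + b ^ 4 / (8 * h ^ 2)) * α
        + 5 / 8 * h * (b ^ 2 / c) + 13 / 24 * (b ^ 2 / c) ^ 3 / h := by
      rw [sectorExcess, hasin_b, hsqrt_b]
    have hpb : arcExcess h b = (1 + b ^ 2 / (2 * h ^ 2)) * α + 3 / 2 * (b ^ 2 / c) / h := by
      rw [arcExcess, hasin_b, hsqrt_b]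
    rw [hJd₄ t h₃ htc, hK₁', hK₂, hK₃, hK₄, hJh, hH₂s', hH₂s', hH₂d' a hha.le, hH₂d' h le_rfl,
      hH₃s', hH₃s', hH₃d' b hab, hH₃d' a le_rfl, hH₄s', hH₄d' t h₃, hH₄d' b le_rfl,
      arcExcess_self hh₀, arcExcess_self ha, arcExcess_self hb,
      sectorExcess_self hh₀, sectorExcess_self ha, sectorExcess_self hb,
      sectorIntegral_of_le_mul_cos hh₀ hα₀ hα₁ htα,
      sectorIntegral_of_le_mul_cos hh₀ hβ₀ hβ₁ htβ',
      sectorIntegral_of_mul_cos_le ha hβ₀ hβ₁.le ht₀ htβa,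
      sectorIntegral_of_mul_cos_le hb hα₀ hα₁.le ht₀ htαb,
      hsin', hcos', hsin, hcos, htan, htan', hA, hu]
    exact sum_sectorIntegral_eq_of_legs_le ha hb hc₀ hcc hh hΘ₁ hΘ₂ hΘ₄ hΘ₆ hqa hpa hqb hpb
  · rw [volume_euclidean_pairs_eq a b (hc₀.le.trans htc) T hT, trianglePairs_disk_eq_univ ha hb
      (hcc ▸ pow_le_pow_left₀ hc₀.le htc 2), volume_trianglePairs_univ ha hb, hA]
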